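/- Fix d ∈ ℕ and let S := (Fin d → Bool) be the mask space; for a mask m ∈ S and x ∈ ℝ^d, write x_m for the restriction of x to the observed coordinates {i : m i = true} and x_{1−m} for the restriction to the missing coordinates {i : m i = false}. Let (Ω, P) be a probability space, X : Ω → ℝ^d a random vector with law Q (the previous imputation), M : Ω → S a mask variable, and suppose the laws involved admit densities with the density of (X_m, M) strictly positive. Let X' : Ω → ℝ^d be an imputed vector that agrees with X on the observed coordinates (X'_m = X_m whenever M = m) and leaves the mask unchanged, and suppose that for law(M)-almost every m and almost every x_m, the conditional law of X'_{1−m} given (X'_m = x_m, M = m) equals the conditional law under Q of the coordinates in {i : m i = false} given that the coordinates in {i : m i = true} equal x_m. Then KL(law(X', M) ‖ Q ⊗ law(M)) ≤ KL(law(X'', M) ‖ Q ⊗ law(M)) for every other imputed vector X'' that agrees with X on observed coordinates and leaves the mask unchanged. (This is the distributional content of Theorem 1: an imputer whose conditional law of the imputed missing coordinates, given the observed coordinates and the mask, matches the reference conditional law — such as the rectified-flow imputer g* obtained by solving the imputation ODE — is an optimal MIRI imputer.) -/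

import Mathlib

open MeasureTheory ProbabilityTheory
open scoped ENNReal Classical

/-- The Kullback–Leibler divergence `KL(μ ‖ ν)`: equal to `∫ log (dμ/dν) dμ` if `μ ≪ ν` and the
integral is defined, and `+∞` otherwise. -/
noncomputable def klDiv {α : Type*} [MeasurableSpace α] (μ ν : Measure α) : ℝ≥0∞ :=
  if μ ≪ ν ∧ Integrable (llr μ ν) μ then ENNReal.ofReal (∫ x, llr μ ν x ∂μ) else ⊤

/-- Restriction `x_m` of `x ∈ ℝ^d` to the observed coordinates `{i : m i = true}` of a mask. -/
def restObs {d : ℕ} (m : Fin d → Bool) (x : Fin d → ℝ) : {i : Fin d // m i = true} → ℝ :=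
  fun i => x i

/-- Restriction `x_{1−m}` of `x ∈ ℝ^d` to the missing coordinates `{i : m i = false}`. -/
def restMis {d : ℕ} (m : Fin d → Bool) (x : Fin d → ℝ) : {i : Fin d // m i = false} → ℝ :=
  fun i => x i

/-- The KL divergence between probability measures agrees with Mathlib's. -/
lemma klDiv_eq_informationTheory_klDiv {α : Type*} [MeasurableSpace α] (μ ν : Measure α)
    [IsProbabilityMeasure μ] [IsProbabilityMeasure ν] :
    klDiv μ ν = InformationTheory.klDiv μ ν := by
  by_cases h : μ ≪ ν ∧ Integrable (llr μ ν) μ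
  · rw [klDiv, if_pos h, InformationTheory.klDiv_of_ac_of_integrable h.1 h.2]
    simp
  · rw [klDiv, if_neg h, eq_comm, InformationTheory.klDiv_eq_top_iff]
    exact fun h₁ h₂ => h ⟨h₁, h₂⟩

lemma measurable_restObs {d : ℕ} (m : Fin d → Bool) : Measurable (restObs m) :=
  measurable_pi_lambda _ fun i => measurable_pi_apply (i : Fin d)

lemma measurable_restMis {d : ℕ} (m : Fin d → Bool) : Measurable (restMis m) :=
  measurable_pi_lambda _ fun i => measurable_pi_apply (i : Fin d)

/-- The vector with prescribed observed and missing blocks. -/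
def mergeBlocks {d : ℕ} (m : Fin d → Bool)
    (p : ({i : Fin d // m i = true} → ℝ) × ({i : Fin d // m i = false} → ℝ)) : Fin d → ℝ :=
  fun i => if h : m i = true then p.1 ⟨i, h⟩ else p.2 ⟨i, by simpa using h⟩

lemma measurable_mergeBlocks {d : ℕ} (m : Fin d → Bool) : Measurable (mergeBlocks m) := by
  refine measurable_pi_lambda _ fun i => ?_
  by_cases h : m i = true
  · simp only [mergeBlocks, h, dite_true]
    fun_prop
  · simp only [mergeBlocks, h, dite_false, Bool.false_eq_true]
    fun_prop

@[simp]
lemma mergeBlocks_restObs_restMis {d : ℕ} (m : Fin d → Bool) (x : Fin d → ℝ) :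
    mergeBlocks m (restObs m x, restMis m x) = x := by
  ext i
  simp [mergeBlocks, restObs, restMis]

/-- The kernel that keeps the observed block and resamples the missing block from its conditional
law under `Q`. -/
noncomputable def resample {d : ℕ} (Q : Measure (Fin d → ℝ)) [IsFiniteMeasure Q]
    (m : Fin d → Bool) : Kernel (Fin d → ℝ) (Fin d → ℝ) :=
  ((Kernel.id ×ₖ condDistrib (restMis m) (restObs m) Q).map (mergeBlocks m)).comap
    (restObs m) (measurable_restObs m)

instance {d : ℕ} (Q : Measure (Fin d → ℝ)) [IsFiniteMeasure Q] (m : Fin d → Bool) :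
    IsMarkovKernel (resample Q m) := by
  have := Kernel.IsMarkovKernel.map (Kernel.id ×ₖ condDistrib (restMis m) (restObs m) Q)
    (measurable_mergeBlocks m)
  unfold resample
  infer_instance

lemma resample_congr {d : ℕ} (Q : Measure (Fin d → ℝ)) [IsFiniteMeasure Q] {m : Fin d → Bool}
    {x y : Fin d → ℝ} (h : restObs m x = restObs m y) : resample Q m x = resample Q m y := by
  simp [resample, Kernel.comap_apply, h]

/-- Resampling preserves any law whose conditional law of the missing block is that of `Q`. -/
lemma resample_comp_map {Ω : Type*} [MeasurableSpace Ω] {d : ℕ} (Q : Measure (Fin d → ℝ))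
    [IsFiniteMeasure Q] (m : Fin d → Bool) (μ : Measure Ω) [IsFiniteMeasure μ]
    {Y : Ω → (Fin d → ℝ)} (hY : Measurable Y)
    (h : condDistrib (fun ω => restMis m (Y ω)) (fun ω => restObs m (Y ω)) μ
      =ᵐ[μ.map fun ω => restObs m (Y ω)] condDistrib (restMis m) (restObs m) Q) :
    resample Q m ∘ₘ μ.map Y = μ.map Y := by
  have hO : Measurable fun ω => restObs m (Y ω) := (measurable_restObs m).comp hY
  have hN : Measurable fun ω => restMis m (Y ω) := (measurable_restMis m).comp hY
  have h₁ : resample Q m ∘ₘ μ.map Y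
      = ((Kernel.id ×ₖ condDistrib (restMis m) (restObs m) Q).map (mergeBlocks m))
        ∘ₘ μ.map fun ω => restObs m (Y ω) := by
    ext s hs
    rw [Measure.bind_apply hs (Kernel.aemeasurable _),
      Measure.bind_apply hs (Kernel.aemeasurable _),
      lintegral_map (Kernel.measurable_coe _ hs) hY, lintegral_map (Kernel.measurable_coe _ hs) hO]
    rfl
  rw [h₁, ← Measure.map_comp _ _ (measurable_mergeBlocks m), ← Measure.compProd_eq_comp_prod,
    ← Measure.compProd_congr h, compProd_map_condDistrib hN.aemeasurable,
    Measure.map_map (measurable_mergeBlocks m) (hO.prodMk hN)]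
  congr 1
  ext1 ω
  simp

/-- The kernel resampling the missing block of a masked vector, keeping the mask. -/
noncomputable def resampleMasked {d : ℕ} (Q : Measure (Fin d → ℝ)) [IsFiniteMeasure Q] :
    Kernel ((Fin d → ℝ) × (Fin d → Bool)) ((Fin d → ℝ) × (Fin d → Bool)) where
  toFun p := (resample Q p.2 p.1).map fun x => (x, p.2)
  measurable' := by
    refine measurable_from_prod_countable_left fun m => ?_
    exact (Measure.measurable_map _ measurable_prodMk_right).comp (resample Q m).measurable

lemma resampleMasked_apply {d : ℕ} (Q : Measure (Fin d → ℝ)) [IsFiniteMeasure Q]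
    (p : (Fin d → ℝ) × (Fin d → Bool)) :
    resampleMasked Q p = (resample Q p.2 p.1).map fun x => (x, p.2) := rfl

instance {d : ℕ} (Q : Measure (Fin d → ℝ)) [IsFiniteMeasure Q] :
    IsMarkovKernel (resampleMasked Q) := by
  refine ⟨fun p => ?_⟩
  rw [resampleMasked_apply]
  exact Measure.isProbabilityMeasure_map measurable_prodMk_right.aemeasurable

/-- Erasure of the missing coordinates of a masked vector. -/
def eraseMis {d : ℕ} (p : (Fin d → ℝ) × (Fin d → Bool)) : (Fin d → ℝ) × (Fin d → Bool) :=
  (fun i => if p.2 i = true then p.1 i else 0, p.2)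

lemma measurable_eraseMis {d : ℕ} : Measurable (eraseMis (d := d)) := by
  refine measurable_from_prod_countable_left fun m => ?_
  refine Measurable.prodMk (measurable_pi_lambda _ fun i => ?_) measurable_const
  by_cases h : m i = true
  · simp only [h, if_true]
    fun_prop
  · simp only [h, if_false, Bool.false_eq_true]
    fun_prop

lemma resampleMasked_eraseMis {d : ℕ} (Q : Measure (Fin d → ℝ)) [IsFiniteMeasure Q]
    (p : (Fin d → ℝ) × (Fin d → Bool)) :
    resampleMasked Q (eraseMis p) = resampleMasked Q p := by
  rw [resampleMasked_apply, resampleMasked_apply]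
  have : restObs p.2 (eraseMis p).1 = restObs p.2 p.1 := by
    ext i
    simp [restObs, eraseMis, i.2]
  exact congrArg (fun μ => Measure.map (fun x => (x, p.2)) μ) (resample_congr Q this)

/-- If resampling preserves the law of `Y` on each mask event, then the joint law of `(Y, M)` is
recovered by resampling from its observed part. -/
lemma resampleMasked_comp_map_eraseMis {Ω : Type*} [MeasurableSpace Ω] {d : ℕ}
    (Q : Measure (Fin d → ℝ)) [IsFiniteMeasure Q] (μ : Measure Ω)
    {Y : Ω → (Fin d → ℝ)} {M : Ω → (Fin d → Bool)} (hY : Measurable Y) (hM : Measurable M)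
    (h : ∀ m, resample Q m ∘ₘ (μ.restrict (M ⁻¹' {m})).map Y = (μ.restrict (M ⁻¹' {m})).map Y) :
    resampleMasked Q ∘ₘ (μ.map fun ω => (Y ω, M ω)).map eraseMis = μ.map fun ω => (Y ω, M ω) := by
  have hYM : Measurable fun ω => (Y ω, M ω) := hY.prodMk hM
  have hmeas (m : Fin d → Bool) : MeasurableSet (M ⁻¹' {m}) := hM (measurableSet_singleton m)
  have hsum : μ = ∑ m, μ.restrict (M ⁻¹' {m}) := by
    rw [← Measure.sum_fintype, ← Measure.restrict_iUnion _ hmeas,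
      ← Set.preimage_iUnion, Set.iUnion_of_singleton, Set.preimage_univ, Measure.restrict_univ]
    intro a b hab
    exact Disjoint.preimage _ (by simpa using hab)
  ext s hs
  have hsec (m : Fin d → Bool) : MeasurableSet {x : Fin d → ℝ | (x, m) ∈ s} :=
    (show Measurable fun x : Fin d → ℝ => (x, m) by fun_prop) hs
  rw [Measure.bind_apply hs (Kernel.aemeasurable _),
    lintegral_map (Kernel.measurable_coe _ hs) measurable_eraseMis]
  simp_rw [resampleMasked_eraseMis]
  rw [lintegral_map (Kernel.measurable_coe _ hs) hYM, Measure.map_apply hYM hs, hsum,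
    lintegral_finsetSum_measure, Measure.finsetSum_apply]
  refine Finset.sum_congr rfl fun m _ => ?_
  have hm : (μ.restrict (M ⁻¹' {m})) ((fun ω => (Y ω, M ω)) ⁻¹' s)
      = (μ.restrict (M ⁻¹' {m})).map Y {x | (x, m) ∈ s} := by
    rw [Measure.map_apply hY (hsec m)]
    refine measure_congr ?_
    filter_upwards [ae_restrict_mem (hmeas m)] with ω hω
    have hω' : M ω = m := hω
    change ((Y ω, M ω) ∈ s) = ((Y ω, m) ∈ s)
    rw [hω']
  rw [hm, ← h m, Measure.bind_apply (hsec m) (Kernel.aemeasurable _),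
    lintegral_map (Kernel.measurable_coe _ (hsec m)) hY]
  refine lintegral_congr_ae ?_
  filter_upwards [ae_restrict_mem (hmeas m)] with ω hω
  have hω' : M ω = m := hω
  rw [resampleMasked_apply, hω', Measure.map_apply (by fun_prop) hs]
  rfl

/-- Distributional content of Theorem 1: an imputer `X'` that agrees with the data `X` on the
observed coordinates, leaves the mask unchanged, and whose conditional law of the imputed missing
coordinates given the observed coordinates and the mask matches the corresponding conditional law
of the reference measure `Q = law(X)`, minimizes `KL(law(·, M) ‖ Q ⊗ law(M))` among all such
imputers. -/
theorem matching_conditional_imputer_is_optimal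
    {Ω : Type*} [MeasurableSpace Ω] (P : Measure Ω) [IsProbabilityMeasure P]
    {d : ℕ} (X X' : Ω → (Fin d → ℝ)) (M : Ω → (Fin d → Bool))
    (hX : Measurable X) (hX' : Measurable X') (hM : Measurable M)
    (Q : Measure (Fin d → ℝ)) [IsProbabilityMeasure Q]
    (hXQ : P.map X = Q)
    -- the laws involved admit densities, with the density of `(X_m, M)` strictly positive
    (hdens : ∀ m : Fin d → Bool, ∃ pObs : ({i : Fin d // m i = true} → ℝ) → ℝ≥0∞,
      Measurable pObs ∧ (∀ xo, 0 < pObs xo) ∧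
        (P.restrict (M ⁻¹' {m})).map (fun ω => restObs m (X ω))
          = (volume : Measure ({i : Fin d // m i = true} → ℝ)).withDensity pObs)
    -- `X'` agrees with `X` on the observed coordinates (and the mask is unchanged)
    (hagree : ∀ ω, ∀ i : Fin d, M ω i = true → X' ω i = X ω i)
    -- the conditional law of the imputed missing block given the observed block and the mask
    -- coincides with the reference conditional law under `Q`
    (hcond : ∀ᵐ m ∂(P.map M),
      ∀ᵐ xo ∂((P.restrict (M ⁻¹' {m})).map (fun ω => restObs m (X' ω))),
        condDistrib (fun ω => restMis m (X' ω)) (fun ω => restObs m (X' ω))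
            (P.restrict (M ⁻¹' {m})) xo
          = condDistrib (restMis m) (restObs m) Q xo) :
    ∀ X'' : Ω → (Fin d → ℝ), Measurable X'' →
      (∀ ω, ∀ i : Fin d, M ω i = true → X'' ω i = X ω i) →
      klDiv (P.map (fun ω => (X' ω, M ω))) (Q.prod (P.map M))
        ≤ klDiv (P.map (fun ω => (X'' ω, M ω))) (Q.prod (P.map M)) := by
  intro X'' hX'' hagree''
  have : IsProbabilityMeasure (P.map M) := Measure.isProbabilityMeasure_map hM.aemeasurable
  have hXM' : Measurable fun ω => (X' ω, M ω) := hX'.prodMk hM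
  have hXM'' : Measurable fun ω => (X'' ω, M ω) := hX''.prodMk hM
  have : IsProbabilityMeasure (P.map fun ω => (X' ω, M ω)) :=
    Measure.isProbabilityMeasure_map hXM'.aemeasurable
  have : IsProbabilityMeasure (P.map fun ω => (X'' ω, M ω)) :=
    Measure.isProbabilityMeasure_map hXM''.aemeasurable
  rw [klDiv_eq_informationTheory_klDiv, klDiv_eq_informationTheory_klDiv]
  have h_law : resampleMasked Q ∘ₘ (P.map fun ω => (X' ω, M ω)).map eraseMis
      = P.map fun ω => (X' ω, M ω) := by
    refine resampleMasked_comp_map_eraseMis Q P hX' hM fun m => ?_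
    by_cases hm : P.map M {m} = 0
    · rw [Measure.map_apply hM (measurableSet_singleton m)] at hm
      simp [Measure.restrict_eq_zero.mpr hm]
    · refine resample_comp_map Q m _ hX' ?_
      by_contra hne
      exact hm (measure_mono_null (Set.singleton_subset_iff.mpr hne) (ae_iff.mp hcond))
  have h_ref : resampleMasked Q ∘ₘ (Q.prod (P.map M)).map eraseMis = Q.prod (P.map M) := by
    have h := resampleMasked_comp_map_eraseMis Q (Q.prod (P.map M)) measurable_fst measurable_snd
      fun m => ?_
    · simpa using h
    · have hQ : resample Q m ∘ₘ Q = Q := by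
        simpa using resample_comp_map Q m Q measurable_id (ae_eq_refl _)
      have hrest : ((Q.prod (P.map M)).restrict (Prod.snd ⁻¹' {m})).map Prod.fst
          = (P.map M {m}) • Q := by
        rw [← Set.univ_prod, ← Measure.prod_restrict, Measure.restrict_univ,
          Measure.map_fst_prod, Measure.restrict_apply_univ]
      rw [hrest, Measure.comp_smul, hQ]
  have h_erase : (P.map fun ω => (X' ω, M ω)).map eraseMis
      = (P.map fun ω => (X'' ω, M ω)).map eraseMis := by
    rw [Measure.map_map measurable_eraseMis hXM', Measure.map_map measurable_eraseMis hXM'']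
    congr 1
    ext1 ω
    refine Prod.ext (funext fun i => ?_) rfl
    by_cases hi : M ω i = true
    · simp [eraseMis, hi, hagree ω i hi, hagree'' ω i hi]
    · simp [eraseMis, hi]
  calc InformationTheory.klDiv (P.map fun ω => (X' ω, M ω)) (Q.prod (P.map M))
      = InformationTheory.klDiv
          (resampleMasked Q ∘ₘ (P.map fun ω => (X'' ω, M ω)).map eraseMis)
          (resampleMasked Q ∘ₘ (Q.prod (P.map M)).map eraseMis) := by
        rw [← h_erase, h_law, h_ref]
    _ ≤ InformationTheory.klDiv ((P.map fun ω => (X'' ω, M ω)).map eraseMis)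
          ((Q.prod (P.map M)).map eraseMis) := InformationTheory.klDiv_comp_right_le _ _ _
    _ ≤ InformationTheory.klDiv (P.map fun ω => (X'' ω, M ω)) (Q.prod (P.map M)) :=
        InformationTheory.klDiv_map_le _ _ measurable_eraseMis
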